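/- (Lemma 2, width version) Let A be a finite family of n rectangles with widths wᵢ and heights lᵢ, let ΔA = (Δw₁, Δl₁, …, Δwₙ, Δlₙ) be such that A′ = A + ΔA has all sides positive, and let M be any positioning of A′ attaining the best packing efficiency, i.e. η(M) = η₀(A′) (equivalently T(M) = T₀(A′)). Then p(M) ≤ Σᵢ wᵢ + Σᵢ |Δwᵢ|. -/

import Mathlib

open Set Finset Function

/-- A positioning of a family of rectangles (widths `w`, heights `l`) assigns
lower-left corners `(a i, b i)` so that the open interiors are pairwise disjoint. -/
def IsPositioning {ι : Type*} (w l a b : ι → ℝ) : Prop :=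
  ∀ i j, i ≠ j →
    Disjoint (Set.Ioo (a i) (a i + w i) ×ˢ Set.Ioo (b i) (b i + l i))
             (Set.Ioo (a j) (a j + w j) ×ˢ Set.Ioo (b j) (b j + l j))

/-- Horizontal extent `p(M) = max_{i,j} ((a i + w i) - a j)`. -/
noncomputable def pval {n : ℕ} (w a : Fin n → ℝ) : ℝ :=
  ⨆ i, ⨆ j, (a i + w i - a j)

/-- Vertical extent `q(M) = max_{i,j} ((b i + l i) - b j)`. -/
noncomputable def qval {n : ℕ} (l b : Fin n → ℝ) : ℝ :=
  ⨆ i, ⨆ j, (b i + l i - b j)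

/-- Bounding area `T(M) = p(M) * q(M)`. -/
noncomputable def Tval {n : ℕ} (w l a b : Fin n → ℝ) : ℝ :=
  pval w a * qval l b

/-- Total area `S(A) = ∑ i, w i * l i`. -/
noncomputable def Sval {n : ℕ} (w l : Fin n → ℝ) : ℝ :=
  ∑ i, w i * l i

/-- Packing efficiency `η(M) = S(A) / T(M)`. -/
noncomputable def eta {n : ℕ} (w l a b : Fin n → ℝ) : ℝ :=
  Sval w l / Tval w l a b

/-- Best packing efficiency `η₀(A) = sup over positionings M of η(M)`. -/
noncomputable def eta0 {n : ℕ} (w l : Fin n → ℝ) : ℝ :=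
  sSup {e | ∃ a b : Fin n → ℝ, IsPositioning w l a b ∧ e = eta w l a b}

/-- Minimal bounding area `T₀(A) = inf over positionings M of T(M)`. -/
noncomputable def T0 {n : ℕ} (w l : Fin n → ℝ) : ℝ :=
  sInf {t | ∃ a b : Fin n → ℝ, IsPositioning w l a b ∧ t = Tval w l a b}

/-- Two open rectangles with positive sides are disjoint iff they are separated along an axis. -/
lemma disjoint_Ioo_prod_iff {a₁ w₁ b₁ l₁ a₂ w₂ b₂ l₂ : ℝ}
    (hw₁ : 0 < w₁) (hl₁ : 0 < l₁) (hw₂ : 0 < w₂) (hl₂ : 0 < l₂) :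
    Disjoint (Set.Ioo a₁ (a₁ + w₁) ×ˢ Set.Ioo b₁ (b₁ + l₁))
        (Set.Ioo a₂ (a₂ + w₂) ×ˢ Set.Ioo b₂ (b₂ + l₂)) ↔
      (a₁ + w₁ ≤ a₂ ∨ a₂ + w₂ ≤ a₁) ∨ (b₁ + l₁ ≤ b₂ ∨ b₂ + l₂ ≤ b₁) := by
  rw [Set.disjoint_prod, Set.Ioo_disjoint_Ioo, Set.Ioo_disjoint_Ioo]
  simp only [min_le_iff, le_max_iff]
  grind

lemma le_pval {n : ℕ} (w a : Fin n → ℝ) (i j : Fin n) : a i + w i - a j ≤ pval w a :=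
  (le_ciSup (f := fun j => a i + w i - a j) (Set.finite_range _).bddAbove j).trans
    (le_ciSup (f := fun i => ⨆ j, (a i + w i - a j)) (Set.finite_range _).bddAbove i)

lemma width_le_pval {n : ℕ} (w a : Fin n → ℝ) (i : Fin n) : w i ≤ pval w a := by
  simpa using le_pval w a i i

lemma bddAbove_eta {n : ℕ} {w l : Fin (n + 1) → ℝ} (hw : ∀ i, 0 < w i) (hl : ∀ i, 0 < l i) :
    BddAbove {e | ∃ a b : Fin (n + 1) → ℝ, IsPositioning w l a b ∧ e = eta w l a b} := by
  refine ⟨Sval w l / (w 0 * l 0), ?_⟩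
  rintro _ ⟨a, b, -, rfl⟩
  have hS : 0 ≤ Sval w l := Finset.sum_nonneg fun i _ => (mul_pos (hw i) (hl i)).le
  exact div_le_div_of_nonneg_left hS (mul_pos (hw 0) (hl 0))
    (mul_le_mul (width_le_pval w a 0) (width_le_pval l b 0) (hl 0).le
      ((hw 0).le.trans (width_le_pval w a 0)))

/-- The gaps between the horizontal projections can be closed by a monotone map which translates
each projection, so that the total extent is at most the sum of the widths. -/
lemma exists_monotone_compression {n : ℕ} {w : Fin n → ℝ} (hw : ∀ i, 0 < w i) (a : Fin n → ℝ) :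
    ∃ φ : ℝ → ℝ, Monotone φ ∧ (∀ i, φ (a i + w i) = φ (a i) + w i) ∧
      ∀ x y, φ x - φ y ≤ ∑ i, w i := by
  let U : Set ℝ := ⋃ i, Set.Ioc (a i) (a i + w i)
  have hU : MeasureTheory.volume.real U ≤ ∑ i, w i := by
    refine (MeasureTheory.measureReal_iUnion_fintype_le _).trans (Finset.sum_le_sum fun i _ => ?_)
    simp [(hw i).le]
  have hfin : MeasureTheory.volume U ≠ ⊤ := by
    refine ne_of_lt ((MeasureTheory.measure_iUnion_fintype_le _ _).trans_lt ?_)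
    simp [ENNReal.sum_lt_top]
  have hfin' : ∀ x, MeasureTheory.volume (U ∩ Set.Iic x) ≠ ⊤ := fun x =>
    ne_top_of_le_ne_top hfin (MeasureTheory.measure_mono Set.inter_subset_left)
  refine ⟨fun x => MeasureTheory.volume.real (U ∩ Set.Iic x), fun x y hxy => ?_, fun i => ?_,
    fun x y => ?_⟩
  · exact MeasureTheory.measureReal_mono
      (Set.inter_subset_inter_right _ (Set.Iic_subset_Iic.2 hxy)) (hfin' y)
  · have hsplit : U ∩ Set.Iic (a i + w i) = (U ∩ Set.Iic (a i)) ∪ Set.Ioc (a i) (a i + w i) := by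
      have hsub : Set.Ioc (a i) (a i + w i) ⊆ U :=
        Set.subset_iUnion (fun i => Set.Ioc (a i) (a i + w i)) i
      rw [← Set.Iic_union_Ioc_eq_Iic (le_add_of_nonneg_right (hw i).le),
        Set.inter_union_distrib_left, Set.inter_eq_right.2 hsub]
    have hdisj : Disjoint (U ∩ Set.Iic (a i)) (Set.Ioc (a i) (a i + w i)) :=
      (Set.Iic_disjoint_Ioc le_rfl).mono_left Set.inter_subset_right
    simp only [hsplit]
    rw [MeasureTheory.measureReal_union hdisj measurableSet_Ioc (hfin' _) (by simp)]
    simp [(hw i).le]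
  · have h₁ : MeasureTheory.volume.real (U ∩ Set.Iic x) ≤ MeasureTheory.volume.real U :=
      MeasureTheory.measureReal_mono Set.inter_subset_left hfin
    have h₂ : 0 ≤ MeasureTheory.volume.real (U ∩ Set.Iic y) := MeasureTheory.measureReal_nonneg
    dsimp only
    linarith

/-- Any positioning can be compressed horizontally to extent at most the sum of the widths,
keeping the vertical coordinates. -/
lemma exists_isPositioning_pval_le_sum {n : ℕ} {w l a b : Fin (n + 1) → ℝ}
    (hw : ∀ i, 0 < w i) (hl : ∀ i, 0 < l i) (hM : IsPositioning w l a b) :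
    ∃ a', IsPositioning w l a' b ∧ pval w a' ≤ ∑ i, w i := by
  obtain ⟨φ, hmono, hadd, hle⟩ := exists_monotone_compression hw a
  refine ⟨φ ∘ a, fun i j hij => ?_, ciSup_le fun i => ciSup_le fun j => ?_⟩
  · have h := hM i j hij
    rw [disjoint_Ioo_prod_iff (hw i) (hl i) (hw j) (hl j)] at h ⊢
    refine h.imp_left (Or.imp (fun h => ?_) fun h => ?_)
    · simpa [hadd] using hmono h
    · simpa [hadd] using hmono h
  · simpa [hadd] using hle (a i + w i) (a j)

/-- A positioning attaining the best packing efficiency is no wider than the sum of the widths. -/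
lemma pval_le_sum_of_eta_eq_eta0 {n : ℕ} {w l a b : Fin (n + 1) → ℝ}
    (hw : ∀ i, 0 < w i) (hl : ∀ i, 0 < l i) (hM : IsPositioning w l a b)
    (hopt : eta w l a b = eta0 w l) : pval w a ≤ ∑ i, w i := by
  obtain ⟨a', hM', hle⟩ := exists_isPositioning_pval_le_sum hw hl hM
  by_contra! hlt
  have hS : 0 < Sval w l :=
    Finset.sum_pos (fun i _ => mul_pos (hw i) (hl i)) Finset.univ_nonempty
  have hp : 0 < pval w a' := (hw 0).trans_le (width_le_pval w a' 0)
  have hq : 0 < qval l b := (hl 0).trans_le (width_le_pval l b 0)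
  have hbetter : eta w l a b < eta w l a' b :=
    div_lt_div_of_pos_left hS (mul_pos hp hq) (mul_lt_mul_of_pos_right (hle.trans_lt hlt) hq)
  have hmax : eta w l a' b ≤ eta0 w l := le_csSup (bddAbove_eta hw hl) ⟨a', b, hM', rfl⟩
  exact absurd (hopt ▸ hmax) hbetter.not_ge

/-- Lemma 2, width version: any positioning of the perturbed family
`A' = A + ΔA` attaining the best packing efficiency has horizontal extent at most
`∑ wᵢ + ∑ |Δwᵢ|`. -/
theorem optimal_p_bound {n : ℕ} (w l Δw Δl : Fin (n + 1) → ℝ)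
    (hw : ∀ i, 0 < w i) (hl : ∀ i, 0 < l i)
    (hw' : ∀ i, 0 < w i + Δw i) (hl' : ∀ i, 0 < l i + Δl i)
    (a b : Fin (n + 1) → ℝ)
    (hM : IsPositioning (fun i => w i + Δw i) (fun i => l i + Δl i) a b)
    (hopt : eta (fun i => w i + Δw i) (fun i => l i + Δl i) a b
      = eta0 (fun i => w i + Δw i) (fun i => l i + Δl i)) :
    pval (fun i => w i + Δw i) a ≤ (∑ i, w i) + ∑ i, |Δw i| := by
  refine (pval_le_sum_of_eta_eq_eta0 hw' hl' hM hopt).trans ?_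
  rw [← Finset.sum_add_distrib]
  exact Finset.sum_le_sum fun i _ => add_le_add_right (le_abs_self _) _
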